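/- Let A, B > 0 and θ ≥ 2, and for ν > 0 consider the set Σ_ν = {σ ∈ (0, +∞) : A σ^{2/2*_s(t)} < σ + B ν σ^{θ/2*_s(t)}}. Then for every ε > 0 there exists ν̃ > 0 such that inf_{σ ∈ Σ_ν} σ > (1−ε) A^{(N−t)/(2s−t)} for every 0 < ν < ν̃. -/

import Mathlib

open MeasureTheory Filter Topology Set

noncomputable section

namespace FracHS

/-- Euclidean space `ℝ^N`. -/
abbrev Eu (N : ℕ) := EuclideanSpace ℝ (Fin N)

/-- The critical fractional Hardy–Sobolev exponent `2*_s(t) = 2(N-t)/(N-2s)`. -/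
def twoStar (N : ℕ) (s t : ℝ) : ℝ := 2 * ((N : ℝ) - t) / ((N : ℝ) - 2 * s)

/-- The Gagliardo bilinear pairing `∬ (u(x)-u(y))(φ(x)-φ(y))/|x-y|^{N+2s}`. -/
def gagPair (N : ℕ) (s : ℝ) (u φ : Eu N → ℝ) : ℝ :=
  ∫ x : Eu N, ∫ y : Eu N, (u x - u y) * (φ x - φ y) / ‖x - y‖ ^ ((N : ℝ) + 2 * s)

/-- The squared Gagliardo seminorm. -/
def gag (N : ℕ) (s : ℝ) (u : Eu N → ℝ) : ℝ := gagPair N s u u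

/-- The Hardy bilinear pairing `∫ u φ/|x|^{2s}`. -/
def hardyPair (N : ℕ) (s : ℝ) (u φ : Eu N → ℝ) : ℝ :=
  ∫ x : Eu N, u x * φ x / ‖x‖ ^ (2 * s)

/-- The Hardy integral `∫ u²/|x|^{2s}`. -/
def hardyInt (N : ℕ) (s : ℝ) (u : Eu N → ℝ) : ℝ := hardyPair N s u u

/-- The best constant `Λ_{N,s}` in the fractional Hardy inequality. -/
def Lam (N : ℕ) (s : ℝ) : ℝ :=
  sSup {c : ℝ | ∀ u : Eu N → ℝ, ContDiff ℝ (⊤ : ℕ∞) u → HasCompactSupport u →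
    c * hardyInt N s u ≤ gag N s u}

/-- Membership in `𝒟^{s,2}(ℝ^N)`, the closure of `C_c^∞(ℝ^N)` in the Gagliardo seminorm. -/
def memD (N : ℕ) (s : ℝ) (u : Eu N → ℝ) : Prop :=
  ∃ φ : ℕ → Eu N → ℝ,
    (∀ n, ContDiff ℝ (⊤ : ℕ∞) (φ n) ∧ HasCompactSupport (φ n)) ∧
    Tendsto (fun n => gag N s (fun x => u x - φ n x)) atTop (𝓝 0)

/-- The squared norm `‖u‖²_{λ,s}`. -/
def normLamSq (N : ℕ) (s lam : ℝ) (u : Eu N → ℝ) : ℝ :=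
  gag N s u - lam * hardyInt N s u

/-- The squared norm `‖(u,v)‖²_𝔻`. -/
def normDSq (N : ℕ) (s l1 l2 : ℝ) (u v : Eu N → ℝ) : ℝ :=
  normLamSq N s l1 u + normLamSq N s l2 v

/-- Weighted integral `∫ |u|^p/|x|^t`. -/
def intHS (N : ℕ) (t p : ℝ) (u : Eu N → ℝ) : ℝ :=
  ∫ x : Eu N, |u x| ^ p / ‖x‖ ^ t

/-- The coupling integral `∫ h |u|^α |v|^β/|x|^t`. -/
def couple (N : ℕ) (t a b : ℝ) (h u v : Eu N → ℝ) : ℝ :=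
  ∫ x : Eu N, h x * |u x| ^ a * |v x| ^ b / ‖x‖ ^ t

/-- The bilinear form associated with `‖·‖²_{λ,s}`. -/
def bilin (N : ℕ) (s lam : ℝ) (u φ : Eu N → ℝ) : ℝ :=
  gagPair N s u φ - lam * hardyPair N s u φ

/-- The energy functional `J_ν`. -/
def J (N : ℕ) (s t l1 l2 a b ν : ℝ) (h u v : Eu N → ℝ) : ℝ :=
  (1 / 2) * normLamSq N s l1 u + (1 / 2) * normLamSq N s l2 v
    - (1 / twoStar N s t) *
        (intHS N t (twoStar N s t) u + intHS N t (twoStar N s t) v)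
    - ν * couple N t a b h u v

/-- The pairing `⟨J_ν'(u,v),(φ,ψ)⟩`. -/
def Jderiv (N : ℕ) (s t l1 l2 a b ν : ℝ) (h u v φ ψ : Eu N → ℝ) : ℝ :=
  bilin N s l1 u φ + bilin N s l2 v ψ
    - ∫ x : Eu N, |u x| ^ (twoStar N s t - 2) * u x * φ x / ‖x‖ ^ t
    - ∫ x : Eu N, |v x| ^ (twoStar N s t - 2) * v x * ψ x / ‖x‖ ^ t
    - ν * ∫ x : Eu N, h x * (a * |u x| ^ (a - 2) * u x * |v x| ^ b * φ x
        + b * |u x| ^ a * |v x| ^ (b - 2) * v x * ψ x) / ‖x‖ ^ t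

/-- The pairing `⟨Ψ'(u,v),(φ,ψ)⟩` where `Ψ(u,v) = ⟨J_ν'(u,v),(u,v)⟩`. -/
def PsiDeriv (N : ℕ) (s t l1 l2 a b ν : ℝ) (h u v φ ψ : Eu N → ℝ) : ℝ :=
  2 * (bilin N s l1 u φ + bilin N s l2 v ψ)
    - twoStar N s t * ∫ x : Eu N, |u x| ^ (twoStar N s t - 2) * u x * φ x / ‖x‖ ^ t
    - twoStar N s t * ∫ x : Eu N, |v x| ^ (twoStar N s t - 2) * v x * ψ x / ‖x‖ ^ t
    - ν * (a + b) * ∫ x : Eu N, h x * (a * |u x| ^ (a - 2) * u x * |v x| ^ b * φ x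
        + b * |u x| ^ a * |v x| ^ (b - 2) * v x * ψ x) / ‖x‖ ^ t

/-- The second derivative `J_ν''(u,v)[(w,z),(w,z)]`. -/
def Jsecond (N : ℕ) (s t l1 l2 a b ν : ℝ) (h u v w z : Eu N → ℝ) : ℝ :=
  normDSq N s l1 l2 w z
    - (twoStar N s t - 1) * ∫ x : Eu N,
        (|u x| ^ (twoStar N s t - 2) * (w x) ^ 2
          + |v x| ^ (twoStar N s t - 2) * (z x) ^ 2) / ‖x‖ ^ t
    - ν * ∫ x : Eu N, h x * (a * (a - 1) * |u x| ^ (a - 2) * |v x| ^ b * (w x) ^ 2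
        + 2 * a * b * |u x| ^ (a - 2) * u x * |v x| ^ (b - 2) * v x * w x * z x
        + b * (b - 1) * |u x| ^ a * |v x| ^ (b - 2) * (z x) ^ 2) / ‖x‖ ^ t

/-- The Nehari manifold `N_ν`. -/
def Nehari (N : ℕ) (s t l1 l2 a b ν : ℝ) (h : Eu N → ℝ) :
    Set ((Eu N → ℝ) × (Eu N → ℝ)) :=
  {p | memD N s p.1 ∧ memD N s p.2 ∧ p ≠ (0, 0) ∧
    normDSq N s l1 l2 p.1 p.2 =
      intHS N t (twoStar N s t) p.1 + intHS N t (twoStar N s t) p.2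
        + ν * (a + b) * couple N t a b h p.1 p.2}

/-- The Nehari manifold `N_j` of the decoupled functional `J_j`. -/
def NehariSingle (N : ℕ) (s t lam : ℝ) : Set (Eu N → ℝ) :=
  {w | memD N s w ∧ w ≠ 0 ∧ normLamSq N s lam w = intHS N t (twoStar N s t) w}

/-- The Hardy–Sobolev constant `S(λ,t,s)`. -/
def Sconst (N : ℕ) (s t lam : ℝ) : ℝ :=
  sInf {r : ℝ | ∃ u : Eu N → ℝ, memD N s u ∧ u ≠ 0 ∧
    r = normLamSq N s lam u / intHS N t (twoStar N s t) u ^ (2 / twoStar N s t)}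

/-- The semitrivial energy level `𝒞(λ,t,s)`. -/
def Cconst (N : ℕ) (s t lam : ℝ) : ℝ :=
  ((2 * s - t) / (2 * ((N : ℝ) - t))) *
    Sconst N s t lam ^ (((N : ℝ) - t) / (2 * s - t))

/-- A positive extremal `z^{λ,t,s}`: a positive weak solution of the scalar equation
attaining `S(λ,t,s)`. -/
def IsExtremal (N : ℕ) (s t lam : ℝ) (z : Eu N → ℝ) : Prop :=
  memD N s z ∧ (∀ x : Eu N, x ≠ 0 → 0 < z x) ∧
  intHS N t (twoStar N s t) z ≠ 0 ∧
  normLamSq N s lam z / intHS N t (twoStar N s t) z ^ (2 / twoStar N s t)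
    = Sconst N s t lam ∧
  ∀ φ : Eu N → ℝ, memD N s φ →
    bilin N s lam z φ = ∫ x : Eu N, |z x| ^ (twoStar N s t - 2) * z x * φ x / ‖x‖ ^ t

/-- The rescaling `z_μ(x) = μ^{-(N-2s)/2} z(x/μ)`. -/
def scaleFn (N : ℕ) (s μ : ℝ) (z : Eu N → ℝ) : Eu N → ℝ :=
  fun x => μ ^ (-(((N : ℝ) - 2 * s) / 2)) * z (μ⁻¹ • x)

/-- Hypothesis (H) on the function `h`. -/
def HypH (N : ℕ) (s t a b : ℝ) (h : Eu N → ℝ) : Prop :=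
  (a + b < twoStar N s t ∧
    Integrable (fun x : Eu N =>
      h x ^ (twoStar N s t / (twoStar N s t - a - b)) / ‖x‖ ^ t)) ∨
  (a + b = twoStar N s t ∧ eLpNorm h ⊤ volume < ⊤)

/-- Hypothesis (H1) on the function `h`: continuity around `0` and `∞`, with
`h(0) = 0` and `h(x) → 0` as `|x| → ∞`. -/
def HypH1 (N : ℕ) (h : Eu N → ℝ) : Prop :=
  (∃ U ∈ 𝓝 (0 : Eu N), ContinuousOn h U) ∧ h 0 = 0 ∧
  (∃ R : ℝ, ContinuousOn h {x : Eu N | R ≤ ‖x‖}) ∧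
  Tendsto h (cocompact (Eu N)) (𝓝 0)

/-- Palais–Smale sequence for `J_ν` at level `c`. -/
def PSseqJ (N : ℕ) (s t l1 l2 a b ν : ℝ) (h : Eu N → ℝ)
    (u v : ℕ → Eu N → ℝ) (c : ℝ) : Prop :=
  Tendsto (fun n => J N s t l1 l2 a b ν h (u n) (v n)) atTop (𝓝 c) ∧
  ∀ ε > 0, ∀ᶠ n in atTop, ∀ φ ψ : Eu N → ℝ, memD N s φ → memD N s ψ →
    normDSq N s l1 l2 φ ψ ≤ 1 →
    |Jderiv N s t l1 l2 a b ν h (u n) (v n) φ ψ| ≤ ε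

/-- Strong convergence in `𝔻`. -/
def TendstoD (N : ℕ) (s l1 l2 : ℝ) (u v : ℕ → Eu N → ℝ) (u0 v0 : Eu N → ℝ) : Prop :=
  Tendsto (fun n => normDSq N s l1 l2
    (fun x => u n x - u0 x) (fun x => v n x - v0 x)) atTop (𝓝 0)

/-- Positive part `u⁺ = max{u,0}`. -/
def pPart (N : ℕ) (u : Eu N → ℝ) : Eu N → ℝ := fun x => max (u x) 0

/-- Negative part `u⁻ = min{u,0}`. -/
def nPart (N : ℕ) (u : Eu N → ℝ) : Eu N → ℝ := fun x => min (u x) 0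

/-- The truncated functional `J_ν⁺`. -/
def Jplus (N : ℕ) (s t l1 l2 a b ν : ℝ) (h u v : Eu N → ℝ) : ℝ :=
  (1 / 2) * normLamSq N s l1 u + (1 / 2) * normLamSq N s l2 v
    - (1 / twoStar N s t) * (intHS N t (twoStar N s t) (pPart N u)
        + intHS N t (twoStar N s t) (pPart N v))
    - ν * couple N t a b h (pPart N u) (pPart N v)

/-- The pairing `⟨(J_ν⁺)'(u,v),(φ,ψ)⟩`. -/
def JplusDeriv (N : ℕ) (s t l1 l2 a b ν : ℝ) (h u v φ ψ : Eu N → ℝ) : ℝ :=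
  bilin N s l1 u φ + bilin N s l2 v ψ
    - ∫ x : Eu N, pPart N u x ^ (twoStar N s t - 1) * φ x / ‖x‖ ^ t
    - ∫ x : Eu N, pPart N v x ^ (twoStar N s t - 1) * ψ x / ‖x‖ ^ t
    - ν * ∫ x : Eu N, h x * (a * pPart N u x ^ (a - 1) * pPart N v x ^ b * φ x
        + b * pPart N u x ^ a * pPart N v x ^ (b - 1) * ψ x) / ‖x‖ ^ t

/-- Palais–Smale sequence for `J_ν⁺` at level `c`. -/
def PSseqJplus (N : ℕ) (s t l1 l2 a b ν : ℝ) (h : Eu N → ℝ)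
    (u v : ℕ → Eu N → ℝ) (c : ℝ) : Prop :=
  Tendsto (fun n => Jplus N s t l1 l2 a b ν h (u n) (v n)) atTop (𝓝 c) ∧
  ∀ ε > 0, ∀ᶠ n in atTop, ∀ φ ψ : Eu N → ℝ, memD N s φ → memD N s ψ →
    normDSq N s l1 l2 φ ψ ≤ 1 →
    |JplusDeriv N s t l1 l2 a b ν h (u n) (v n) φ ψ| ≤ ε

/-- Critical point of `J_ν`. -/
def IsCritPt (N : ℕ) (s t l1 l2 a b ν : ℝ) (h u v : Eu N → ℝ) : Prop :=
  memD N s u ∧ memD N s v ∧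
  ∀ φ ψ : Eu N → ℝ, memD N s φ → memD N s ψ →
    Jderiv N s t l1 l2 a b ν h u v φ ψ = 0

/-- Ground state: a nontrivial nonnegative critical point of `J_ν` of minimal energy
among nontrivial nonnegative critical points. -/
def IsGroundState (N : ℕ) (s t l1 l2 a b ν : ℝ) (h u v : Eu N → ℝ) : Prop :=
  IsCritPt N s t l1 l2 a b ν h u v ∧ (u, v) ≠ (0, 0) ∧
  (∀ x, 0 ≤ u x) ∧ (∀ x, 0 ≤ v x) ∧
  ∀ u' v' : Eu N → ℝ, IsCritPt N s t l1 l2 a b ν h u' v' → (u', v') ≠ (0, 0) →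
    (∀ x, 0 ≤ u' x) → (∀ x, 0 ≤ v' x) →
    J N s t l1 l2 a b ν h u v ≤ J N s t l1 l2 a b ν h u' v'

/-- Existence of a positive ground state of the system. -/
def ExistsPosGS (N : ℕ) (s t l1 l2 a b ν : ℝ) (h : Eu N → ℝ) : Prop :=
  ∃ u v : Eu N → ℝ, IsGroundState N s t l1 l2 a b ν h u v ∧
    (∀ x, x ≠ 0 → 0 < u x) ∧ (∀ x, x ≠ 0 → 0 < v x)

/-- The Nehari manifold `N_ν⁺` of the truncated functional. -/
def NehariPlus (N : ℕ) (s t l1 l2 a b ν : ℝ) (h : Eu N → ℝ) :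
    Set ((Eu N → ℝ) × (Eu N → ℝ)) :=
  {p | memD N s p.1 ∧ memD N s p.2 ∧ p ≠ (0, 0) ∧
    normDSq N s l1 l2 p.1 p.2 =
      intHS N t (twoStar N s t) (pPart N p.1) + intHS N t (twoStar N s t) (pPart N p.2)
        + ν * (a + b) * couple N t a b h (pPart N p.1) (pPart N p.2)}

/-- A continuous path in `N_ν⁺` joining `(z₁,0)` to `(0,z₂)`. -/
def IsMPPath (N : ℕ) (s t l1 l2 a b ν : ℝ) (h z1 z2 : Eu N → ℝ)
    (ψ : ℝ → (Eu N → ℝ) × (Eu N → ℝ)) : Prop :=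
  (∀ τ ∈ Icc (0 : ℝ) 1, ψ τ ∈ NehariPlus N s t l1 l2 a b ν h) ∧
  ψ 0 = (z1, 0) ∧ ψ 1 = (0, z2) ∧
  ∀ τ₀ ∈ Icc (0 : ℝ) 1, ∀ ε > 0, ∃ δ > 0, ∀ τ ∈ Icc (0 : ℝ) 1, |τ - τ₀| < δ →
    normDSq N s l1 l2 (fun x => (ψ τ).1 x - (ψ τ₀).1 x)
      (fun x => (ψ τ).2 x - (ψ τ₀).2 x) < ε

/-- The Mountain-Pass level `c_MP`. -/
def cMP (N : ℕ) (s t l1 l2 a b ν : ℝ) (h z1 z2 : Eu N → ℝ) : ℝ :=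
  sInf {c : ℝ | ∃ ψ : ℝ → (Eu N → ℝ) × (Eu N → ℝ),
    IsMPPath N s t l1 l2 a b ν h z1 z2 ψ ∧
    c = sSup ((fun τ => Jplus N s t l1 l2 a b ν h (ψ τ).1 (ψ τ).2) '' Icc (0 : ℝ) 1)}

/-- `p` is a local minimum of `J_ν` restricted to the Nehari manifold `N_ν`. -/
def IsLocalMinNehari (N : ℕ) (s t l1 l2 a b ν : ℝ) (h : Eu N → ℝ)
    (p : (Eu N → ℝ) × (Eu N → ℝ)) : Prop :=
  p ∈ Nehari N s t l1 l2 a b ν h ∧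
  ∃ δ > 0, ∀ q ∈ Nehari N s t l1 l2 a b ν h,
    normDSq N s l1 l2 (fun x => q.1 x - p.1 x) (fun x => q.2 x - p.2 x) < δ →
    J N s t l1 l2 a b ν h p.1 p.2 ≤ J N s t l1 l2 a b ν h q.1 q.2

/-- There are points of `N_ν` arbitrarily close to `p` with strictly smaller energy. -/
def HasNearbySmaller (N : ℕ) (s t l1 l2 a b ν : ℝ) (h : Eu N → ℝ)
    (p : (Eu N → ℝ) × (Eu N → ℝ)) : Prop :=
  ∀ δ > 0, ∃ q ∈ Nehari N s t l1 l2 a b ν h,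
    normDSq N s l1 l2 (fun x => q.1 x - p.1 x) (fun x => q.2 x - p.2 x) < δ ∧
    J N s t l1 l2 a b ν h q.1 q.2 < J N s t l1 l2 a b ν h p.1 p.2

/-- `(0,z)` is a saddle point of `J_ν` restricted to `N_ν`: a minimum along the slice
`{0} × N₂` but with nearby points of `N_ν` of strictly smaller energy. -/
def IsSaddleNehari2 (N : ℕ) (s t l1 l2 a b ν : ℝ) (h z : Eu N → ℝ) : Prop :=
  (0, z) ∈ Nehari N s t l1 l2 a b ν h ∧
  (∀ w ∈ NehariSingle N s t l2,
    J N s t l1 l2 a b ν h 0 z ≤ J N s t l1 l2 a b ν h 0 w) ∧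
  HasNearbySmaller N s t l1 l2 a b ν h (0, z)

/-- `(z,0)` is a saddle point of `J_ν` restricted to `N_ν`: a minimum along the slice
`N₁ × {0}` but with nearby points of `N_ν` of strictly smaller energy. -/
def IsSaddleNehari1 (N : ℕ) (s t l1 l2 a b ν : ℝ) (h z : Eu N → ℝ) : Prop :=
  (z, 0) ∈ Nehari N s t l1 l2 a b ν h ∧
  (∀ w ∈ NehariSingle N s t l1,
    J N s t l1 l2 a b ν h z 0 ≤ J N s t l1 l2 a b ν h w 0) ∧
  HasNearbySmaller N s t l1 l2 a b ν h (z, 0)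

end FracHS

open FracHS

/-- Members of the sublevel set cannot lie below `c` once `ν` is small, where
`c ^ (1 - p) < A`. -/
theorem le_of_sublevel {A B c p q : ℝ} (hB : 0 < B) (hc : 0 < c) (hp : p < 1)
    (hpq : p ≤ q) {ν σ : ℝ} (hν0 : 0 < ν) (hν : ν < (A - c ^ (1 - p)) / (B * c ^ (q - p)))
    (hσ : 0 < σ) (h : A * σ ^ p < σ + B * ν * σ ^ q) : c ≤ σ := by
  by_contra! hlt
  have hσp : 0 < σ ^ p := Real.rpow_pos_of_pos hσ p
  have h1 : σ = σ ^ (1 - p) * σ ^ p := by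
    rw [← Real.rpow_add hσ, sub_add_cancel, Real.rpow_one]
  have h2 : σ ^ q = σ ^ (q - p) * σ ^ p := by
    rw [← Real.rpow_add hσ, sub_add_cancel]
  have h3 : A < σ ^ (1 - p) + B * ν * σ ^ (q - p) := by
    refine lt_of_mul_lt_mul_right ?_ hσp.le
    calc A * σ ^ p < σ + B * ν * σ ^ q := h
      _ = σ ^ (1 - p) * σ ^ p + B * ν * (σ ^ (q - p) * σ ^ p) := by rw [← h1, ← h2]
      _ = (σ ^ (1 - p) + B * ν * σ ^ (q - p)) * σ ^ p := by ring
  have h4 : σ ^ (1 - p) ≤ c ^ (1 - p) := Real.rpow_le_rpow hσ.le hlt.le (by linarith)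
  have h5 : B * ν * σ ^ (q - p) ≤ B * ν * c ^ (q - p) :=
    mul_le_mul_of_nonneg_left (Real.rpow_le_rpow hσ.le hlt.le (by linarith)) (by positivity)
  rw [lt_div_iff₀ (by positivity)] at hν
  linarith

/-- Lemma 2.5: the algebraic lemma. -/
theorem algebraic_lemma
    (N : ℕ) (s t : ℝ)
    (hs0 : 0 < s) (hs1 : s < 1) (ht0 : 0 ≤ t) (hts : t < 2 * s) (hN : 2 * s < (N : ℝ))
    (A B θ : ℝ) (hA : 0 < A) (hB : 0 < B) (hθ : 2 ≤ θ) :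
    ∀ ε > 0, ∃ ν' > 0, ∀ ν : ℝ, 0 < ν → ν < ν' →
      (1 - ε) * A ^ (((N : ℝ) - t) / (2 * s - t)) <
        sInf {σ : ℝ | 0 < σ ∧
          A * σ ^ (2 / twoStar N s t) < σ + B * ν * σ ^ (θ / twoStar N s t)} := by
  intro ε hε
  have hNs : 0 < (N : ℝ) - 2 * s := by linarith
  have hNt : 0 < (N : ℝ) - t := by linarith
  have hst : 0 < 2 * s - t := by linarith
  have hstar : 0 < twoStar N s t := by unfold twoStar; positivity
  have hexp : ((N : ℝ) - t) / (2 * s - t) * (1 - 2 / twoStar N s t) = 1 := by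
    unfold twoStar
    field_simp
    ring
  have hpq : 2 / twoStar N s t ≤ θ / twoStar N s t := by gcongr
  set P := ((N : ℝ) - t) / (2 * s - t) with hP
  set p := 2 / twoStar N s t
  set q := θ / twoStar N s t
  have hPpos : 0 < P := div_pos hNt hst
  have hp : p < 1 := by
    have := pos_of_mul_pos_right (hexp ▸ one_pos) hPpos.le
    linarith
  have hAP : 0 < A ^ P := Real.rpow_pos_of_pos hA P
  obtain ⟨δ, hδ0, hδ1, hδε⟩ : ∃ δ : ℝ, 0 < δ ∧ δ < 1 ∧ δ < ε := by
    obtain ⟨δ, h0, h⟩ := exists_between (lt_min one_pos hε)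
    exact ⟨δ, h0, lt_min_iff.mp h⟩
  set c := (1 - δ) * A ^ P with hcdef
  have hc : 0 < c := mul_pos (by linarith) hAP
  have hcA : c ^ (1 - p) < A := by
    calc c ^ (1 - p) < (A ^ P) ^ (1 - p) :=
          Real.rpow_lt_rpow hc.le (by nlinarith) (by linarith)
      _ = A := by rw [← Real.rpow_mul hA.le, hexp, Real.rpow_one]
  refine ⟨(A - c ^ (1 - p)) / (B * c ^ (q - p)),
    div_pos (sub_pos.mpr hcA) (by positivity), fun ν hν0 hν => ?_⟩
  have hcε : (1 - ε) * A ^ P < c := mul_lt_mul_of_pos_right (by linarith) hAP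
  refine hcε.trans_le (le_csInf ⟨A ^ P, hAP, ?_⟩ fun σ hσ =>
    le_of_sublevel hB hc hp hpq hν0 hν hσ.1 hσ.2)
  have hfix : A * (A ^ P) ^ p = A ^ P := by
    rw [← Real.rpow_mul hA.le, ← Real.rpow_one_add' hA.le (by nlinarith)]
    congr 1
    linarith
  rw [hfix]
  have : 0 < B * ν * (A ^ P) ^ q := by positivity
  linarith
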